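/- arXiv:1507.07485 — 2 statements merged into one kernel-verified Lean document; each statement's English description precedes it below -/
import Mathlib

section
/- Let c ∈ C be nonzero, let q, t ∈ C be such that neither q nor t is a root of unity, t ≠ q and qt ≠ 1, and set a_i := c^i (q^i − 1)/(1 − t^i). Then the algebra Λ_a is Cohen–Macaulay: it is a free module of rank 2 over C[Q_1,Q_2] with basis {1, Q_3}, and its Hilbert series is (1+u^3)/((1−u)(1−u^2)). -/
open MvPolynomial

set_option synthInstance.maxHeartbeats 1000000
set_option maxHeartbeats 1000000

noncomputable section

/-- The polynomial ring `ℂ[y,z]`, with `y = X 0`, `z = X 1`. -/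
abbrev R2 := MvPolynomial (Fin 2) ℂ

/-- The generalized power sum `Q_i = a_i y^i + z^i`. -/
def Q2 (a : ℕ → ℂ) (i : ℕ) : R2 := C (a i) * X 0 ^ i + X 1 ^ i

/-- The algebra `Λ_a` generated by the `Q_i`, `i ≥ 1`. -/
def Lam (a : ℕ → ℂ) : Subalgebra ℂ R2 :=
  Algebra.adjoin ℂ {f : R2 | ∃ i : ℕ, 1 ≤ i ∧ f = Q2 a i}

/-- The subalgebra `ℂ[Q_1, Q_2]`. -/
def Bsub (a : ℕ → ℂ) : Subalgebra ℂ R2 :=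
  Algebra.adjoin ℂ {Q2 a 1, Q2 a 2}

/-- `Λ_a`, viewed as a module over `ℂ[Q_1,Q_2]` (as the `ℂ[Q_1,Q_2]`-span of `Λ_a` in
`ℂ[y,z]`, which coincides with `Λ_a` since `Q_1, Q_2 ∈ Λ_a`). -/
def LamMod (a : ℕ → ℂ) : Submodule ↥(Bsub a) R2 :=
  Submodule.span (Bsub a) (Lam a : Set R2)

/-- The degree-`n` homogeneous component of a graded subspace of `ℂ[y,z]`. -/
def comp2 (M : Submodule ℂ R2) (n : ℕ) : Submodule ℂ R2 :=
  M ⊓ homogeneousSubmodule (Fin 2) ℂ n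

/-- The Hilbert series of a graded subspace of `ℂ[y,z]`, as a power series over `ℚ`. -/
def hilb2 (M : Submodule ℂ R2) : PowerSeries ℚ :=
  PowerSeries.mk fun n => (Module.finrank ℂ (comp2 M n) : ℚ)

lemma C_inv_mul_C {r : ℂ} (hr : r ≠ 0) : (C r⁻¹ : R2) * C r = 1 := by
  rw [← C_mul, inv_mul_cancel₀ hr, C_1]

/-- The linear form `a_2 y - a_1 z`, orthogonal to `Q_1` with respect to `Q_2`. -/
def orthForm (a : ℕ → ℂ) : R2 := C (a 2) * X 0 - C (a 1) * X 1

/-- The `ℂ[Q_1,Q_2]`-submodule of `ℂ[y,z]` spanned by `1` and `Q_3`. -/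
def pairSpan (a : ℕ → ℂ) : Submodule (Bsub a) R2 :=
  Submodule.span (Bsub a) {(1 : R2), Q2 a 3}

lemma Q2_one_mem_Bsub (a : ℕ → ℂ) : Q2 a 1 ∈ Bsub a :=
  Algebra.subset_adjoin (by simp)

lemma Q2_two_mem_Bsub (a : ℕ → ℂ) : Q2 a 2 ∈ Bsub a :=
  Algebra.subset_adjoin (by simp)

lemma C_mem_Bsub (a : ℕ → ℂ) (r : ℂ) : (C r : R2) ∈ Bsub a :=
  (Bsub a).algebraMap_mem r

lemma aeval_Q2_one_mem_Bsub (a : ℕ → ℂ) (h : Polynomial ℂ) :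
    Polynomial.aeval (Q2 a 1) h ∈ Bsub a :=
  (Algebra.adjoin_le (Set.singleton_subset_iff.2 (Q2_one_mem_Bsub a)))
    (Polynomial.aeval_mem_adjoin_singleton ℂ (Q2 a 1))

lemma orthForm_sq (a : ℕ → ℂ) :
    orthForm a ^ 2 = C (a 2 + a 1 ^ 2) * Q2 a 2 - C (a 2) * Q2 a 1 ^ 2 := by
  simp only [orthForm, Q2, map_add, map_pow]
  ring

lemma orthForm_sq_mem_Bsub (a : ℕ → ℂ) : orthForm a ^ 2 ∈ Bsub a := by
  rw [orthForm_sq]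
  exact sub_mem (mul_mem (C_mem_Bsub a _) (Q2_two_mem_Bsub a))
    (mul_mem (C_mem_Bsub a _) (pow_mem (Q2_one_mem_Bsub a) 2))

lemma Bsub_mul_mem_pairSpan {a : ℕ → ℂ} {b s : R2} (hb : b ∈ Bsub a) (hs : s ∈ pairSpan a) :
    b * s ∈ pairSpan a :=
  (pairSpan a).smul_mem ⟨b, hb⟩ hs

lemma Bsub_mem_pairSpan {a : ℕ → ℂ} {b : R2} (hb : b ∈ Bsub a) : b ∈ pairSpan a := by
  have h1 : (1 : R2) ∈ pairSpan a := Submodule.subset_span (by simp)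
  simpa using Bsub_mul_mem_pairSpan hb h1

lemma Q2_three_mem_pairSpan (a : ℕ → ℂ) : Q2 a 3 ∈ pairSpan a :=
  Submodule.subset_span (by simp)

/-- The part of `(a_2 + a_1^2)^3 Q_3` that is even in `orthForm a`. -/
def evenPart (a : ℕ → ℂ) : R2 :=
  C (a 3 * a 1 ^ 3 + a 2 ^ 3) * Q2 a 1 ^ 3
    + C (3 * (a 3 * a 1 + a 2 * a 1 ^ 2)) * Q2 a 1 * orthForm a ^ 2

lemma evenPart_mem_Bsub (a : ℕ → ℂ) : evenPart a ∈ Bsub a :=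
  add_mem (mul_mem (C_mem_Bsub a _) (pow_mem (Q2_one_mem_Bsub a) 3))
    (mul_mem (mul_mem (C_mem_Bsub a _) (Q2_one_mem_Bsub a)) (orthForm_sq_mem_Bsub a))

lemma Q2_three_eq (a : ℕ → ℂ) :
    C ((a 2 + a 1 ^ 2) ^ 3) * Q2 a 3 = evenPart a
      + orthForm a * (C (a 3 - a 1 ^ 3) * orthForm a ^ 2
        + C (3 * (a 3 * a 1 ^ 2 - a 2 ^ 2 * a 1)) * Q2 a 1 ^ 2) := by
  have h3 : (C 3 : R2) = 3 := map_ofNat C 3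
  simp only [evenPart, orthForm, Q2, map_add, map_sub, map_mul, map_pow, h3]
  ring

/-- `f` lies in `pairSpan a + orthForm a * ℂ[Q_1]`. -/
def HasDecomp (a : ℕ → ℂ) (f : R2) : Prop :=
  ∃ s ∈ pairSpan a, ∃ h : Polynomial ℂ, f = s + orthForm a * Polynomial.aeval (Q2 a 1) h

namespace HasDecomp

variable {a : ℕ → ℂ} {f g b : R2}

lemma add (hf : HasDecomp a f) (hg : HasDecomp a g) : HasDecomp a (f + g) := by
  obtain ⟨s, hs, h, rfl⟩ := hf
  obtain ⟨s', hs', h', rfl⟩ := hg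
  refine ⟨s + s', add_mem hs hs', h + h', ?_⟩
  rw [map_add]
  ring

lemma of_mem_pairSpan (hf : f ∈ pairSpan a) : HasDecomp a f :=
  ⟨f, hf, 0, by simp⟩

lemma orthForm_mul_aeval (h : Polynomial ℂ) :
    HasDecomp a (orthForm a * Polynomial.aeval (Q2 a 1) h) :=
  ⟨0, zero_mem _, h, by simp⟩

lemma Q2_one_mul (hf : HasDecomp a f) : HasDecomp a (Q2 a 1 * f) := by
  obtain ⟨s, hs, h, rfl⟩ := hf
  refine ⟨Q2 a 1 * s, Bsub_mul_mem_pairSpan (Q2_one_mem_Bsub a) hs, Polynomial.X * h, ?_⟩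
  rw [map_mul, Polynomial.aeval_X]
  ring

lemma C_mul (r : ℂ) (hf : HasDecomp a f) : HasDecomp a (C r * f) := by
  obtain ⟨s, hs, h, rfl⟩ := hf
  refine ⟨C r * s, Bsub_mul_mem_pairSpan (C_mem_Bsub a r) hs, Polynomial.C r * h, ?_⟩
  rw [map_mul, Polynomial.aeval_C, algebraMap_eq]
  ring

lemma orthForm_sq_mul (ha : a 3 ≠ a 1 ^ 3) (hf : HasDecomp a f) :
    HasDecomp a (orthForm a ^ 2 * f) := by
  obtain ⟨s, hs, h, rfl⟩ := hf
  have hα : (C (a 3 - a 1 ^ 3)⁻¹ : R2) * C (a 3 - a 1 ^ 3) = 1 :=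
      C_inv_mul_C (sub_ne_zero.2 ha)
  set γ := 3 * (a 3 * a 1 ^ 2 - a 2 ^ 2 * a 1)
  have key : orthForm a ^ 3 = C (a 3 - a 1 ^ 3)⁻¹ *
      (C ((a 2 + a 1 ^ 2) ^ 3) * Q2 a 3 - evenPart a)
        + orthForm a * (-(C (a 3 - a 1 ^ 3)⁻¹ * C γ * Q2 a 1 ^ 2)) := by
    rw [Q2_three_eq]
    linear_combination (-orthForm a ^ 3) * hα
  have hcube : HasDecomp a (orthForm a ^ 3 * Polynomial.aeval (Q2 a 1) h) := by
    refine ⟨Polynomial.aeval (Q2 a 1) h * (C (a 3 - a 1 ^ 3)⁻¹ *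
      (C ((a 2 + a 1 ^ 2) ^ 3) * Q2 a 3 - evenPart a)), ?_,
      -(Polynomial.C (a 3 - a 1 ^ 3)⁻¹ * Polynomial.C γ * Polynomial.X ^ 2) * h, ?_⟩
    · refine Bsub_mul_mem_pairSpan (aeval_Q2_one_mem_Bsub a h)
        (Bsub_mul_mem_pairSpan (C_mem_Bsub a _) (sub_mem ?_ ?_))
      · exact Bsub_mul_mem_pairSpan (C_mem_Bsub a _) (Q2_three_mem_pairSpan a)
      · exact Bsub_mem_pairSpan (evenPart_mem_Bsub a)
    · rw [key]
      simp only [map_mul, map_neg, map_pow, Polynomial.aeval_C, Polynomial.aeval_X, algebraMap_eq]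
      ring
  have hs' := of_mem_pairSpan (Bsub_mul_mem_pairSpan (orthForm_sq_mem_Bsub a) hs)
  convert hs'.add hcube using 1
  ring

lemma Bsub_mul (hD : a 2 + a 1 ^ 2 ≠ 0) (ha : a 3 ≠ a 1 ^ 3) (hb : b ∈ Bsub a)
    (hf : HasDecomp a f) : HasDecomp a (b * f) := by
  induction hb using Algebra.adjoin_induction generalizing f with
  | mem x hx =>
    rcases hx with rfl | rfl
    · exact hf.Q2_one_mul
    · have hCD : (C (a 2 + a 1 ^ 2)⁻¹ : R2) * C (a 2 + a 1 ^ 2) = 1 :=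
      C_inv_mul_C hD
      have : Q2 a 2 * f = C (a 2 + a 1 ^ 2)⁻¹ *
          (C (a 2) * (Q2 a 1 * (Q2 a 1 * f)) + orthForm a ^ 2 * f) := by
        rw [orthForm_sq]
        linear_combination (-Q2 a 2 * f) * hCD
      rw [this]
      exact ((hf.Q2_one_mul.Q2_one_mul.C_mul _).add (hf.orthForm_sq_mul ha)).C_mul _
  | algebraMap r => exact hf.C_mul r
  | add x y _ _ hx hy => rw [add_mul]; exact (hx hf).add (hy hf)
  | mul x y _ _ hx hy => rw [mul_assoc]; exact hx (hy hf)

lemma orthForm_mul (hD : a 2 + a 1 ^ 2 ≠ 0) (ha : a 3 ≠ a 1 ^ 3) (hf : HasDecomp a f) :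
    HasDecomp a (orthForm a * f) := by
  obtain ⟨s, hs, h, rfl⟩ := hf
  obtain ⟨b₀, b₁, rfl⟩ := Submodule.mem_span_pair.1 hs
  have hw : HasDecomp a (orthForm a) := by simpa using orthForm_mul_aeval (a := a) 1
  have hCD : (C ((a 2 + a 1 ^ 2) ^ 3)⁻¹ : R2) * C ((a 2 + a 1 ^ 2) ^ 3) = 1 :=
      C_inv_mul_C (pow_ne_zero 3 hD)
  set o : R2 := C (a 3 - a 1 ^ 3) * orthForm a ^ 2
    + C (3 * (a 3 * a 1 ^ 2 - a 2 ^ 2 * a 1)) * Q2 a 1 ^ 2 with ho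
  have hoB : o ∈ Bsub a :=
    add_mem (mul_mem (C_mem_Bsub a _) (orthForm_sq_mem_Bsub a))
      (mul_mem (C_mem_Bsub a _) (pow_mem (Q2_one_mem_Bsub a) 2))
  have hwQ : HasDecomp a (orthForm a * Q2 a 3) := by
    have : orthForm a * Q2 a 3 = C ((a 2 + a 1 ^ 2) ^ 3)⁻¹ *
        (evenPart a * orthForm a + orthForm a ^ 2 * o) := by
      linear_combination (-orthForm a * Q2 a 3) * hCD
        + C ((a 2 + a 1 ^ 2) ^ 3)⁻¹ * orthForm a * Q2_three_eq a
    rw [this]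
    exact ((hw.Bsub_mul hD ha (evenPart_mem_Bsub a)).add
      (of_mem_pairSpan (Bsub_mem_pairSpan (mul_mem (orthForm_sq_mem_Bsub a) hoB)))).C_mul _
  have hsq : HasDecomp a (orthForm a ^ 2 * Polynomial.aeval (Q2 a 1) h) :=
    of_mem_pairSpan (Bsub_mem_pairSpan
      (mul_mem (orthForm_sq_mem_Bsub a) (aeval_Q2_one_mem_Bsub a h)))
  convert ((hw.Bsub_mul hD ha b₀.2).add (hwQ.Bsub_mul hD ha b₁.2)).add hsq using 1
  simp only [Subalgebra.smul_def, smul_eq_mul]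
  ring

/-- `ℂ[y,z] = pairSpan a + orthForm a * ℂ[Q_1]`. -/
theorem all (hD : a 2 + a 1 ^ 2 ≠ 0) (ha : a 3 ≠ a 1 ^ 3) (f : R2) : HasDecomp a f := by
  have hCD : (C (a 2 + a 1 ^ 2)⁻¹ : R2) * C (a 2 + a 1 ^ 2) = 1 :=
      C_inv_mul_C hD
  rw [map_add, map_pow] at hCD
  induction f using MvPolynomial.induction_on with
  | C r => exact of_mem_pairSpan (Bsub_mem_pairSpan (C_mem_Bsub a r))
  | add p q hp hq => exact hp.add hq
  | mul_X p i hp =>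
    have hx := hp.Q2_one_mul
    have hw := hp.orthForm_mul hD ha
    obtain rfl | rfl : i = 0 ∨ i = 1 := by omega
    · have : p * X 0 = C (a 2 + a 1 ^ 2)⁻¹ * (C (a 1) * (Q2 a 1 * p) + orthForm a * p) := by
        simp only [Q2, orthForm]
        linear_combination (-p * X 0) * hCD
      rw [this]
      exact ((hx.C_mul _).add hw).C_mul _
    · have : p * X 1 = C (a 2 + a 1 ^ 2)⁻¹ *
          (C (a 2) * (Q2 a 1 * p) + C (-a 1) * (orthForm a * p)) := by
        simp only [Q2, orthForm, map_neg]
        linear_combination (-p * X 1) * hCD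
      rw [this]
      exact ((hx.C_mul _).add (hw.C_mul _)).C_mul _

end HasDecomp

/-- The reflection of `ℂ[y,z]` fixing `Q_1` and negating `orthForm a`. -/
def reflection (a : ℕ → ℂ) : R2 →ₐ[ℂ] R2 :=
  aeval ![C (a 2 + a 1 ^ 2)⁻¹ * (C (a 1) * Q2 a 1 - orthForm a),
    C (a 2 + a 1 ^ 2)⁻¹ * (C (a 2) * Q2 a 1 + C (a 1) * orthForm a)]

theorem reflection_Q2_one {a : ℕ → ℂ} (hD : a 2 + a 1 ^ 2 ≠ 0) :
    reflection a (Q2 a 1) = Q2 a 1 := by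
  have hCD : (C (a 2 + a 1 ^ 2)⁻¹ : R2) * C (a 2 + a 1 ^ 2) = 1 :=
      C_inv_mul_C hD
  rw [map_add, map_pow] at hCD
  conv_lhs => rw [Q2]
  simp only [reflection, map_add, map_mul, map_pow, algHom_C, algebraMap_eq, aeval_X,
    Matrix.cons_val_zero, Matrix.cons_val_one]
  linear_combination Q2 a 1 * hCD

theorem reflection_orthForm {a : ℕ → ℂ} (hD : a 2 + a 1 ^ 2 ≠ 0) :
    reflection a (orthForm a) = -orthForm a := by
  have hCD : (C (a 2 + a 1 ^ 2)⁻¹ : R2) * C (a 2 + a 1 ^ 2) = 1 :=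
      C_inv_mul_C hD
  rw [map_add, map_pow] at hCD
  conv_lhs => rw [orthForm]
  simp only [reflection, map_sub, map_mul, algHom_C, algebraMap_eq, aeval_X,
    Matrix.cons_val_zero, Matrix.cons_val_one]
  linear_combination (-orthForm a) * hCD

theorem reflection_of_mem_Bsub {a : ℕ → ℂ} (hD : a 2 + a 1 ^ 2 ≠ 0) {b : R2} (hb : b ∈ Bsub a) :
    reflection a b = b := by
  have h1 := reflection_Q2_one hD
  have h2 : reflection a (Q2 a 2) = Q2 a 2 := by
    have h := congrArg (reflection a) (orthForm_sq a)
    simp only [map_pow, map_sub, map_mul, algHom_C, algebraMap_eq, h1,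
      reflection_orthForm hD, neg_sq] at h
    have hC : (C (a 2 + a 1 ^ 2) : R2) ≠ 0 := C_ne_zero.2 hD
    exact mul_left_cancel₀ hC (by linear_combination orthForm_sq a - h)
  have : Bsub a ≤ AlgHom.equalizer (reflection a) (AlgHom.id ℂ R2) := by
    refine Algebra.adjoin_le ?_
    rintro x (rfl | rfl)
    exacts [h1, h2]
  exact this hb

theorem reflection_Q2_three_ne {a : ℕ → ℂ} (hD : a 2 + a 1 ^ 2 ≠ 0) (ha : a 3 ≠ a 1 ^ 3) :
    reflection a (Q2 a 3) ≠ Q2 a 3 := by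
  intro heq
  have h := congrArg (reflection a) (Q2_three_eq a)
  simp only [map_pow, map_add, map_mul, algHom_C, algebraMap_eq, heq, reflection_Q2_one hD,
    reflection_orthForm hD, neg_sq, reflection_of_mem_Bsub hD (evenPart_mem_Bsub a)] at h
  have h' := Q2_three_eq a
  simp only [map_pow, map_add, map_mul] at h'
  have h2 := congrArg (eval ![1, -a 1]) (h'.symm.trans h)
  simp only [orthForm, Q2, map_add, map_sub, map_mul, map_neg, map_pow, eval_C, eval_X,
    Matrix.cons_val_zero, Matrix.cons_val_one] at h2
  have h3 : (a 3 - a 1 ^ 3) * (a 2 + a 1 ^ 2) ^ 3 = 0 := by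
    linear_combination h2 / 2
  exact mul_ne_zero (sub_ne_zero.2 ha) (pow_ne_zero 3 hD) h3

theorem linearIndependent_one_Q2_three {a : ℕ → ℂ} (hD : a 2 + a 1 ^ 2 ≠ 0)
    (ha : a 3 ≠ a 1 ^ 3) : LinearIndependent (Bsub a) ![(1 : R2), Q2 a 3] := by
  rw [LinearIndependent.pair_iff]
  rintro ⟨s, hs⟩ ⟨t, ht⟩ h
  simp only [Subalgebra.smul_def, smul_eq_mul, mul_one] at h
  have h' := congrArg (reflection a) h
  simp only [map_add, map_mul, map_zero, reflection_of_mem_Bsub hD hs,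
    reflection_of_mem_Bsub hD ht] at h'
  have ht0 : t = 0 := by
    have : t * (reflection a (Q2 a 3) - Q2 a 3) = 0 := by linear_combination h' - h
    exact (mul_eq_zero.1 this).resolve_right (sub_ne_zero.2 (reflection_Q2_three_ne hD ha))
  subst ht0
  have hs0 : s = 0 := by simpa using h
  exact ⟨Subtype.ext hs0, rfl⟩

theorem pairSpan_le_Lam {a : ℕ → ℂ} {f : R2} (hf : f ∈ pairSpan a) : f ∈ Lam a := by
  have hQ : ∀ i, 1 ≤ i → Q2 a i ∈ Lam a := fun i hi => Algebra.subset_adjoin ⟨i, hi, rfl⟩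
  have hB : Bsub a ≤ Lam a := by
    refine Algebra.adjoin_le ?_
    rintro x (rfl | rfl)
    exacts [hQ 1 le_rfl, hQ 2 one_le_two]
  obtain ⟨b₀, b₁, rfl⟩ := Submodule.mem_span_pair.1 hf
  exact add_mem (mul_mem (hB b₀.2) (one_mem _)) (mul_mem (hB b₁.2) (hQ 3 (by norm_num)))

/-- If all `Q_i` take equal values at `u` and `v`, then so do all `f ∈ Λ_a` on the
corresponding lines. -/
theorem eval_smul_eq_of_mem_Lam {a : ℕ → ℂ} {u v : Fin 2 → ℂ}
    (huv : ∀ i, 1 ≤ i → eval u (Q2 a i) = eval v (Q2 a i)) {f : R2} (hf : f ∈ Lam a) (r : ℂ) :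
    eval (r • u) f = eval (r • v) f := by
  have : Lam a ≤ AlgHom.equalizer (aeval (R := ℂ) (r • u)) (aeval (R := ℂ) (r • v)) := by
    refine Algebra.adjoin_le ?_
    rintro _ ⟨i, hi, rfl⟩
    have h := huv i hi
    simp only [Q2, map_add, map_mul, map_pow, eval_C, eval_X] at h
    simp only [SetLike.mem_coe, AlgHom.mem_equalizer, Q2, map_add, map_mul,
      map_pow, algHom_C, Algebra.algebraMap_self_apply, aeval_X, Pi.smul_apply, smul_eq_mul]
    linear_combination r ^ i * h
  exact this hf

theorem mem_pairSpan_of_eval_smul_eq {a : ℕ → ℂ} (hD : a 2 + a 1 ^ 2 ≠ 0) (ha : a 3 ≠ a 1 ^ 3)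
    {u v : Fin 2 → ℂ} (huv : ∀ i, 1 ≤ i → eval u (Q2 a i) = eval v (Q2 a i))
    (h1 : eval u (Q2 a 1) ≠ 0) (hw : eval u (orthForm a) ≠ eval v (orthForm a))
    {f : R2} (hf : ∀ r : ℂ, eval (r • u) f = eval (r • v) f) : f ∈ pairSpan a := by
  obtain ⟨s, hs, h, rfl⟩ := HasDecomp.all hD ha f
  have hQ : ∀ (r : ℂ) (p : Fin 2 → ℂ), eval (r • p) (Q2 a 1) = r * eval p (Q2 a 1) := by
    intro r p
    simp [Q2]
    ring
  have hO : ∀ (r : ℂ) (p : Fin 2 → ℂ), eval (r • p) (orthForm a) = r * eval p (orthForm a) := by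
    intro r p
    simp [orthForm]
    ring
  have hA : ∀ p : Fin 2 → ℂ,
      eval p (Polynomial.aeval (Q2 a 1) h) = h.eval (eval p (Q2 a 1)) := by
    intro p
    rw [← coe_aeval_eq_eval, RingHom.coe_coe, ← Polynomial.aeval_algHom_apply,
      Polynomial.coe_aeval_eq_eval]
  have hX : Polynomial.X * h = 0 := by
    refine Polynomial.funext fun x => ?_
    have hr := hf (x / eval u (Q2 a 1))
    simp only [map_add, map_mul, hA, hQ, hO, ← huv 1 le_rfl,
      eval_smul_eq_of_mem_Lam huv (pairSpan_le_Lam hs), div_mul_cancel₀ x h1] at hr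
    have h2 : (eval u (orthForm a) - eval v (orthForm a)) * (x * h.eval x) = 0 := by
      field_simp at hr
      linear_combination hr
    simpa [sub_ne_zero.2 hw] using h2
  have h0 : h = 0 := by simpa using hX
  simpa [h0] using hs

theorem eval_smul_of_isHomogeneous {f : R2} {n : ℕ} (hf : f.IsHomogeneous n) (r : ℂ)
    (p : Fin 2 → ℂ) : eval (r • p) f = r ^ n * eval p f := by
  rw [eval_eq', eval_eq', Finset.mul_sum]
  refine Finset.sum_congr rfl fun d hd => ?_
  have hdeg : d 0 + d 1 = n := by
    simpa [Finsupp.weight_apply, Finsupp.sum_fintype] using hf (mem_support_iff.1 hd)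
  simp only [Fin.prod_univ_two, Pi.smul_apply, smul_eq_mul, ← hdeg]
  ring

theorem finrank_homogeneousSubmodule_fin_two (n : ℕ) :
    Module.finrank ℂ (homogeneousSubmodule (Fin 2) ℂ n) = n + 1 := by
  have hset : {d : Fin 2 →₀ ℕ | d.degree = n} =
      ((Finset.univ.finsuppAntidiag n : Finset (Fin 2 →₀ ℕ)) : Set (Fin 2 →₀ ℕ)) := by
    ext d
    simp [Finset.mem_finsuppAntidiag, Finsupp.degree_eq_sum]
  rw [homogeneousSubmodule_eq_finsupp_supported,
    (AddMonoidAlgebra.supportedEquivFinsupp (R := ℂ) (S := ℂ) _).finrank_eq, hset]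
  have hcard : Fintype.card (Finset.univ.finsuppAntidiag n : Finset (Fin 2 →₀ ℕ)) = n + 1 := by
    rw [Fintype.card_coe, Finset.card_finsuppAntidiag_nat_eq_choose]
    simp [add_comm 1 n]
  exact (Module.finrank_finsupp_self ℂ).trans hcard

theorem finrank_comp2_of_eval {M : Submodule ℂ R2} {u v : Fin 2 → ℂ}
    (hM : ∀ f, f ∈ M ↔ ∀ r : ℂ, eval (r • u) f = eval (r • v) f)
    (huv : ∀ n, 1 ≤ n → u 1 ^ n ≠ v 1 ^ n) (n : ℕ) :
    Module.finrank ℂ (comp2 M n) = if n = 0 then 1 else n := by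
  have hfin := finrank_homogeneousSubmodule_fin_two n
  rcases Nat.eq_zero_or_pos n with rfl | hn
  · have hle : homogeneousSubmodule (Fin 2) ℂ 0 ≤ M := fun f hf => by
      have hconst : ∀ p : Fin 2 → ℂ, eval p f = eval 0 f := fun p => by
        simpa using (eval_smul_of_isHomogeneous hf 0 p).symm
      exact (hM f).2 fun r => by rw [hconst, hconst (r • v)]
    rw [comp2, inf_eq_right.2 hle, hfin]
    simp
  · have : FiniteDimensional ℂ (homogeneousSubmodule (Fin 2) ℂ n) :=
      Module.finite_of_finrank_pos (by omega)
    let L : Module.Dual ℂ (homogeneousSubmodule (Fin 2) ℂ n) :=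
      ((aeval (R := ℂ) u).toLinearMap - (aeval (R := ℂ) v).toLinearMap) ∘ₗ Submodule.subtype _
    have hL : ∀ f, L f = eval u (f : R2) - eval v (f : R2) := fun _ => rfl
    have hne : L ≠ 0 := fun h0 => by
      have h := hL ⟨X 1 ^ n, isHomogeneous_X_pow 1 n⟩
      rw [h0] at h
      simp only [LinearMap.zero_apply, map_pow, eval_X] at h
      exact huv n hn (sub_eq_zero.1 h.symm)
    have hker : comp2 M n = (LinearMap.ker L).map (Submodule.subtype _) := by
      ext f
      simp only [comp2, Submodule.mem_inf, Submodule.mem_map, LinearMap.mem_ker, hL,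
        Submodule.subtype_apply, Subtype.exists, exists_and_right, exists_eq_right]
      constructor
      · rintro ⟨hf, hfn⟩
        exact ⟨hfn, sub_eq_zero.2 (by simpa using (hM f).1 hf 1)⟩
      · rintro ⟨hfn, hf⟩
        refine ⟨(hM f).2 fun r => ?_, hfn⟩
        rw [eval_smul_of_isHomogeneous hfn, eval_smul_of_isHomogeneous hfn, sub_eq_zero.1 hf]
    have hrank := Module.Dual.finrank_ker_add_one_of_ne_zero hne
    rw [hker, Submodule.finrank_map_subtype_eq, if_neg hn.ne']
    exact Nat.add_right_cancel (hrank.trans hfin)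

theorem hilb2_mul_eq {M : Submodule ℂ R2}
    (hM : ∀ n, Module.finrank ℂ (comp2 M n) = if n = 0 then 1 else n) :
    hilb2 M * ((1 - PowerSeries.X) * (1 - PowerSeries.X ^ 2)) = 1 + PowerSeries.X ^ 3 := by
  have hexp : hilb2 M * ((1 - PowerSeries.X) * (1 - PowerSeries.X ^ 2)) =
      hilb2 M - hilb2 M * PowerSeries.X ^ 1 - hilb2 M * PowerSeries.X ^ 2
        + hilb2 M * PowerSeries.X ^ 3 := by
    ring
  rw [hexp]
  ext n
  simp only [map_add, map_sub, PowerSeries.coeff_mul_X_pow', PowerSeries.coeff_one,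
    PowerSeries.coeff_X_pow, hilb2, PowerSeries.coeff_mk, hM]
  rcases n with _ | _ | _ | _ | n
  · simp
  · simp
  · norm_num
  · norm_num
  · simp
    ring

/-- If `c ≠ 0`, neither `q` nor `t` is a root of unity, `t ≠ q` and `qt ≠ 1`, and
`a_i = c^i (q^i - 1)/(1 - t^i)`, then `Λ_a` is Cohen–Macaulay: it is a free module of
rank `2` over `ℂ[Q_1,Q_2]` with basis `{1, Q_3}`, and its Hilbert series is
`(1+u^3)/((1-u)(1-u^2))`. -/
theorem lambda_qt_CM (c q t : ℂ) (hc : c ≠ 0)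
    (hq : ∀ n : ℕ, 1 ≤ n → q ^ n ≠ 1) (ht : ∀ n : ℕ, 1 ≤ n → t ^ n ≠ 1)
    (htq : t ≠ q) (hqt : q * t ≠ 1)
    (a : ℕ → ℂ) (ha : ∀ i : ℕ, a i = c ^ i * (q ^ i - 1) / (1 - t ^ i)) :
    LinearIndependent ↥(Bsub a) ![(1 : R2), Q2 a 3] ∧
    Submodule.span (Bsub a) {(1 : R2), Q2 a 3} = LamMod a ∧
    hilb2 (Subalgebra.toSubmodule (Lam a)) *
        ((1 - PowerSeries.X) * (1 - PowerSeries.X ^ 2)) =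
      1 + PowerSeries.X ^ 3 := by
  have hq1 : q - 1 ≠ 0 := sub_ne_zero.2 (by simpa using hq 1 le_rfl)
  have htn : ∀ i, 1 ≤ i → 1 - t ^ i ≠ 0 := fun i hi => sub_ne_zero.2 (ht i hi).symm
  have ht1 : 1 - t ≠ 0 := by simpa using htn 1 le_rfl
  have ht2 : 1 - t ^ 2 ≠ 0 := htn 2 (by norm_num)
  have ht3 : 1 - t ^ 3 ≠ 0 := htn 3 (by norm_num)
  have hqt' : q - t ≠ 0 := sub_ne_zero.2 htq.symm
  have hqt1 : 1 - q * t ≠ 0 := sub_ne_zero.2 hqt.symm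
  have hD : a 2 + a 1 ^ 2 ≠ 0 := by
    have h : a 2 + a 1 ^ 2 = 2 * c ^ 2 * (q - 1) * (q - t) / ((1 - t) * (1 - t ^ 2)) := by
      rw [ha, ha, pow_one, pow_one, pow_one]
      field_simp
      ring
    rw [h]
    exact div_ne_zero (mul_ne_zero (mul_ne_zero (mul_ne_zero two_ne_zero (pow_ne_zero 2 hc)) hq1)
      hqt') (mul_ne_zero ht1 ht2)
  have hα : a 3 ≠ a 1 ^ 3 := by
    have h : a 3 - a 1 ^ 3 =
        3 * c ^ 3 * (q - 1) * (q - t) * (1 - q * t) / ((1 - t) ^ 2 * (1 - t ^ 3)) := by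
      rw [ha, ha, pow_one, pow_one, pow_one]
      field_simp
      ring
    rw [← sub_ne_zero, h]
    exact div_ne_zero (mul_ne_zero (mul_ne_zero (mul_ne_zero (mul_ne_zero three_ne_zero
      (pow_ne_zero 3 hc)) hq1) hqt') hqt1) (mul_ne_zero (pow_ne_zero 2 ht1) ht3)
  have hu : ∀ i, 1 ≤ i → eval ![1 / c, 1] (Q2 a i) = (q ^ i - t ^ i) / (1 - t ^ i) := by
    intro i hi
    have := htn i hi
    simp only [Q2, map_add, map_mul, map_pow, eval_C, eval_X, Matrix.cons_val_zero,
      Matrix.cons_val_one, ha, div_pow, one_pow]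
    field_simp
    ring
  have huv : ∀ i, 1 ≤ i → eval ![1 / c, 1] (Q2 a i) = eval ![t / c, q] (Q2 a i) := by
    intro i hi
    rw [hu i hi]
    have := htn i hi
    simp only [Q2, map_add, map_mul, map_pow, eval_C, eval_X, Matrix.cons_val_zero,
      Matrix.cons_val_one, ha, div_pow]
    field_simp
    ring
  have h1 : eval ![1 / c, 1] (Q2 a 1) ≠ 0 := by
    rw [hu 1 le_rfl, pow_one, pow_one]
    exact div_ne_zero hqt' ht1
  have hw : eval ![1 / c, 1] (orthForm a) ≠ eval ![t / c, q] (orthForm a) := by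
    have h : eval ![1 / c, 1] (orthForm a) - eval ![t / c, q] (orthForm a) =
        2 * c * (q - 1) * (q - t) / (1 - t ^ 2) := by
      simp only [orthForm, map_sub, map_mul, eval_C, eval_X, Matrix.cons_val_zero,
        Matrix.cons_val_one, ha, pow_one]
      field_simp
      ring
    rw [← sub_ne_zero, h]
    exact div_ne_zero (mul_ne_zero (mul_ne_zero (mul_ne_zero two_ne_zero hc) hq1) hqt') ht2
  have hspan : ∀ f, f ∈ Lam a ↔ f ∈ pairSpan a := fun f =>
    ⟨fun hf => mem_pairSpan_of_eval_smul_eq hD hα huv h1 hw (eval_smul_eq_of_mem_Lam huv hf),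
      pairSpan_le_Lam⟩
  refine ⟨linearIndependent_one_Q2_three hD hα, ?_, hilb2_mul_eq (finrank_comp2_of_eval
    (u := ![1 / c, 1]) (v := ![t / c, q]) (fun f => ⟨eval_smul_eq_of_mem_Lam huv, fun hf =>
      pairSpan_le_Lam (mem_pairSpan_of_eval_smul_eq hD hα huv h1 hw hf)⟩) fun n hn => ?_)⟩
  · exact le_antisymm (fun f hf => Submodule.subset_span ((hspan f).2 hf))
      (Submodule.span_le.2 fun f hf => (hspan f).1 hf)
  · simpa using (hq n hn).symm
end
end

section
/- Let a = (a_1, a_2, ...) be a sequence of nonzero complex numbers, and suppose c, q, t ∈ C satisfy a_i = c^i (q^i − 1)/(1 − t^i) for i = 1, 2, 3, where neither q nor t is a root of unity, t ≠ q and t ≠ q^{-1}. If Λ_a is Cohen–Macaulay (equivalently, a free module over C[Q_1,Q_2]), then a_i = c^i (q^i − 1)/(1 − t^i) for all i ≥ 1. -/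
open MvPolynomial

set_option synthInstance.maxHeartbeats 1000000
set_option maxHeartbeats 1000000

noncomputable section

/-- Restriction of a polynomial in `y, z` to the line `(y, z) = (u s, v s)`. -/
def lineEval (u v : ℂ) : R2 →ₐ[ℂ] Polynomial ℂ :=
  aeval ![Polynomial.C u * Polynomial.X, Polynomial.C v * Polynomial.X]

lemma lineEval_Q2 (u v : ℂ) (a : ℕ → ℂ) (i : ℕ) :
    lineEval u v (Q2 a i) = Polynomial.C (a i * u ^ i + v ^ i) * Polynomial.X ^ i := by
  simp only [lineEval, Q2, map_add, map_mul, map_pow, aeval_X, aeval_C,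
    Polynomial.algebraMap_eq, Matrix.cons_val_zero, Matrix.cons_val_one]
  ring

lemma coeff_zero_lineEval (u v : ℂ) (f : R2) :
    (lineEval u v f).coeff 0 = constantCoeff f := by
  have h : (Polynomial.aeval (0 : ℂ)).comp (lineEval u v) = aeval (0 : Fin 2 → ℂ) := by
    ext i
    fin_cases i <;> simp [lineEval]
  have h' := DFunLike.congr_fun h f
  simpa [Polynomial.coeff_zero_eq_eval_zero, Polynomial.aeval_def, Polynomial.eval₂_eq_eval_map,
    aeval_zero] using h'

/-- On the zero line of `Q_1`, elements of `ℂ[Q_1, Q_2]` are even. -/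
lemma coeff_odd_lineEval_of_mem_Bsub {a : ℕ → ℂ} {f : R2} (hf : f ∈ Bsub a) :
    (lineEval 1 (-a 1) f).coeff 1 = 0 ∧ (lineEval 1 (-a 1) f).coeff 3 = 0 := by
  have h : lineEval 1 (-a 1) f ∈ Algebra.adjoin ℂ {(Polynomial.X : Polynomial ℂ) ^ 2} := by
    have hB : Bsub a ≤
        (Algebra.adjoin ℂ {(Polynomial.X : Polynomial ℂ) ^ 2}).comap (lineEval 1 (-a 1)) := by
      refine Algebra.adjoin_le ?_
      rintro _ (rfl | rfl)
      · simp [lineEval_Q2]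
      · simp only [SetLike.mem_coe, Subalgebra.mem_comap, lineEval_Q2]
        exact mul_mem (Subalgebra.algebraMap_mem _ _) (Algebra.subset_adjoin rfl)
    exact hB hf
  rw [Algebra.adjoin_singleton_eq_range_aeval] at h
  obtain ⟨p, hp⟩ := h
  have hp' : Polynomial.expand ℂ 2 p = lineEval 1 (-a 1) f := by
    rw [← hp]
    simp [Polynomial.expand_eq_sum, Polynomial.aeval_eq_sum_range, Polynomial.sum_over_range,
      Algebra.smul_def]
  rw [← hp']
  constructor <;> rw [Polynomial.coeff_expand (by norm_num)] <;> norm_num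

lemma coeff_one_mul (p r : Polynomial ℂ) :
    (p * r).coeff 1 = p.coeff 0 * r.coeff 1 + p.coeff 1 * r.coeff 0 := by
  simp [Polynomial.coeff_mul, Finset.Nat.antidiagonal_succ]

lemma coeff_three_mul (p r : Polynomial ℂ) :
    (p * r).coeff 3 = p.coeff 0 * r.coeff 3 + p.coeff 1 * r.coeff 2 + p.coeff 2 * r.coeff 1
      + p.coeff 3 * r.coeff 0 := by
  simp [Polynomial.coeff_mul, Finset.Nat.antidiagonal_succ]
  ring

lemma coeff_one_lineEval_of_mem_Lam {a : ℕ → ℂ} {f : R2} (hf : f ∈ Lam a) :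
    (lineEval 1 (-a 1) f).coeff 1 = 0 := by
  induction hf using Algebra.adjoin_induction with
  | mem x hx =>
    obtain ⟨i, hi, rfl⟩ := hx
    rw [lineEval_Q2, Polynomial.coeff_C_mul, Polynomial.coeff_X_pow]
    obtain rfl | h := eq_or_ne 1 i
    · simp
    · simp [h]
  | algebraMap r => simp
  | add x y _ _ hx hy => simp [hx, hy]
  | mul x y _ _ hx hy => simp [coeff_one_mul, hx, hy]

lemma coeff_one_lineEval_of_mem_LamMod {a : ℕ → ℂ} {f : R2} (hf : f ∈ LamMod a) :
    (lineEval 1 (-a 1) f).coeff 1 = 0 := by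
  induction hf using Submodule.span_induction with
  | mem x hx => exact coeff_one_lineEval_of_mem_Lam hx
  | zero => simp
  | add x y _ _ hx hy => simp [hx, hy]
  | smul b x _ hx =>
    rw [Subalgebra.smul_def, smul_eq_mul, map_mul, coeff_one_mul, hx,
      (coeff_odd_lineEval_of_mem_Bsub b.2).1]
    simp

lemma coeff_three_lineEval_smul {a : ℕ → ℂ} (b : Bsub a) (m : LamMod a) :
    (lineEval 1 (-a 1) ((b : R2) * m)).coeff 3
      = constantCoeff (b : R2) * (lineEval 1 (-a 1) (m : R2)).coeff 3 := by
  obtain ⟨h1, h3⟩ := coeff_odd_lineEval_of_mem_Bsub b.2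
  rw [map_mul, coeff_three_mul, h1, h3, coeff_one_lineEval_of_mem_LamMod m.2,
    coeff_zero_lineEval]
  ring

lemma span_one_X_eq_top {a : ℕ → ℂ} (h : a 2 + a 1 ^ 2 ≠ 0) :
    Submodule.span (Bsub a) ({1, X 0} : Set R2) = ⊤ := by
  have hQ1 : Q2 a 1 ∈ Bsub a := Algebra.subset_adjoin (by simp)
  have hQ2 : Q2 a 2 ∈ Bsub a := Algebra.subset_adjoin (by simp)
  set k := (a 2 + a 1 ^ 2)⁻¹ with hk
  have hkk : (C k : R2) * (C (a 2) + C (a 1) ^ 2) = 1 := by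
    rw [← C_pow, ← C_add, ← C_mul, hk, inv_mul_cancel₀ h, C_1]
  have hC (r : ℂ) : (C r : R2) ∈ Bsub a := Subalgebra.algebraMap_mem _ r
  have hX (p : R2) (hp : p ∈ Submodule.span (Bsub a) ({1, X 0} : Set R2)) :
      X 0 * p ∈ Submodule.span (Bsub a) ({1, X 0} : Set R2) := by
    obtain ⟨r, s, rfl⟩ := Submodule.mem_span_pair.1 hp
    refine Submodule.mem_span_pair.2
      ⟨s * ⟨_, hC k⟩ * (⟨_, hQ2⟩ - ⟨_, hQ1⟩ ^ 2),
        r + s * ⟨_, hC k⟩ * (⟨_, hC (a 1)⟩ * ⟨_, hQ1⟩ + ⟨_, hC (a 1)⟩ * ⟨_, hQ1⟩), ?_⟩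
    simp only [Subalgebra.smul_def, smul_eq_mul]
    push_cast
    simp only [Q2]
    linear_combination ((s : R2) * X 0 ^ 2) * hkk
  rw [eq_top_iff]
  rintro p -
  induction p using MvPolynomial.induction_on with
  | C r =>
    refine Submodule.mem_span_pair.2 ⟨⟨_, hC r⟩, 0, ?_⟩
    simp [Subalgebra.smul_def]
  | add p r hp hr => exact add_mem hp hr
  | mul_X p i hp =>
    fin_cases i
    · simpa [mul_comm] using hX p hp
    · have : p * X 1 = (⟨_, hQ1⟩ : Bsub a) • p - (⟨_, hC (a 1)⟩ : Bsub a) • (X 0 * p) := by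
        simp only [Subalgebra.smul_def, smul_eq_mul, Q2]
        ring
      change p * X 1 ∈ _
      rw [this]
      exact sub_mem (Submodule.smul_mem _ _ hp) (Submodule.smul_mem _ _ (hX p hp))

lemma mem_LamMod {a : ℕ → ℂ} {f : R2} (hf : f ∈ Lam a) : f ∈ LamMod a :=
  Submodule.subset_span hf

lemma Q2_mem_Lam (a : ℕ → ℂ) {i : ℕ} (hi : 1 ≤ i) : Q2 a i ∈ Lam a :=
  Algebra.subset_adjoin ⟨i, hi, rfl⟩

lemma exists_basis_fin_of_free {R V : Type*} [CommRing R] [Nontrivial R] [AddCommGroup V]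
    [Module R V] (M : Submodule R V) (hM : Module.Free R M) (w : Finset V)
    (hw : Submodule.span R (w : Set V) = ⊤) :
    ∃ n ≤ w.card, Nonempty (Module.Basis (Fin n) R M) := by
  obtain ⟨⟨ι, e⟩⟩ := hM.exists_basis
  have hli : LinearIndependent R fun i => (e i : V) :=
    e.linearIndependent.map' M.subtype (Submodule.ker_subtype _)
  have hcard := linearIndependent_le_span_finset _ hli w hw
  have hfin : Finite ι := Cardinal.mk_lt_aleph0_iff.1 (hcard.trans_lt Cardinal.natCast_lt_aleph0)
  have := Fintype.ofFinite ι
  rw [Cardinal.mk_fintype] at hcard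
  exact ⟨_, Nat.cast_le.1 hcard, ⟨e.reindex (Fintype.equivFin ι)⟩⟩

/-- If `Λ_a` is free over `ℂ[Q_1, Q_2]`, then it equals `ℂ[Q_1, Q_2] + ℂ[Q_1, Q_2] Q_3` up to
multiplication by an element with nonzero constant term. -/
lemma exists_mul_mem_of_free {a : ℕ → ℂ} (h2 : a 2 + a 1 ^ 2 ≠ 0) (h3 : a 3 - a 1 ^ 3 ≠ 0)
    (hfree : Module.Free (Bsub a) (LamMod a)) :
    ∃ D : Bsub a, constantCoeff (D : R2) ≠ 0 ∧
      ∀ f ∈ LamMod a, ∃ r s : Bsub a, (D : R2) * f = r + s * Q2 a 3 := by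
  obtain ⟨n, hcard, ⟨e⟩⟩ := exists_basis_fin_of_free (LamMod a) hfree ({1, X 0} : Finset R2)
    (by push_cast; exact span_one_X_eq_top h2)
  replace hcard : n ≤ 2 := hcard.trans Finset.card_le_two
  have hsum (m : LamMod a) : (m : R2) = ∑ i, (e.repr m i : R2) * (e i : R2) := by
    conv_lhs => rw [← e.sum_repr m]
    rw [AddSubmonoidClass.coe_finsetSum]
    rfl
  have hc0 (m : LamMod a) : constantCoeff (m : R2)
      = ∑ i, constantCoeff (e.repr m i : R2) * constantCoeff (e i : R2) := by
    conv_lhs => rw [hsum m]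
    simp
  have hc3 (m : LamMod a) : (lineEval 1 (-a 1) (m : R2)).coeff 3
      = ∑ i, constantCoeff (e.repr m i : R2) * (lineEval 1 (-a 1) (e i : R2)).coeff 3 := by
    conv_lhs => rw [hsum m]
    rw [map_sum, Polynomial.finsetSum_coeff]
    exact Finset.sum_congr rfl fun i _ => coeff_three_lineEval_smul _ _
  let one : LamMod a := ⟨1, mem_LamMod (one_mem _)⟩
  let Q : LamMod a := ⟨Q2 a 3, mem_LamMod (Q2_mem_Lam a (by norm_num))⟩
  have h10 := hc0 one
  have h13 := hc3 one
  have hQ3 := hc3 Q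
  have e10 : constantCoeff (one : R2) = 1 := by simp [one]
  have e13 : (lineEval 1 (-a 1) (one : R2)).coeff 3 = 0 := by
    simp [one, Polynomial.coeff_one]
  have eQ3 : (lineEval 1 (-a 1) (Q : R2)).coeff 3 = a 3 - a 1 ^ 3 := by
    simp only [Q, lineEval_Q2, Polynomial.coeff_C_mul_X_pow]
    simp only [if_true]
    ring
  rw [e10] at h10
  rw [e13] at h13
  rw [eQ3] at hQ3
  have s1 := hsum one
  have sQ := hsum Q
  interval_cases n
  · simp at h10
  · simp only [Fin.sum_univ_one] at h10 h13 hQ3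
    refine absurd ?_ h3
    linear_combination (a 3 - a 1 ^ 3) * h10
      + constantCoeff (e.repr one 0 : R2) * constantCoeff (e 0 : R2) * hQ3
      - constantCoeff (e.repr Q 0 : R2) * constantCoeff (e 0 : R2) * h13
  · simp only [Fin.sum_univ_two] at h10 h13 hQ3 s1 sQ
    refine ⟨e.repr one 0 * e.repr Q 1 - e.repr one 1 * e.repr Q 0, ?_, ?_⟩
    · intro hD
      push_cast at hD
      simp only [map_sub, map_mul] at hD
      refine h3 ?_
      generalize constantCoeff (e.repr one 0 : R2) = u0 at *
      generalize constantCoeff (e.repr one 1 : R2) = u1 at *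
      generalize constantCoeff (e.repr Q 0 : R2) = v0 at *
      generalize constantCoeff (e.repr Q 1 : R2) = v1 at *
      generalize constantCoeff (e 0 : R2) = x0 at *
      generalize constantCoeff (e 1 : R2) = x1 at *
      generalize (lineEval 1 (-a 1) (e 0 : R2)).coeff 3 = y0 at *
      generalize (lineEval 1 (-a 1) (e 1 : R2)).coeff 3 = y1 at *
      generalize a 3 - a 1 ^ 3 = g at *
      have : g = (u0 * v1 - u1 * v0) * (x0 * y1 - x1 * y0) := by
        linear_combination g * h10 + (u0 * x0 + u1 * x1) * hQ3
          - (v0 * x0 + v1 * x1) * h13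
      rw [this, hD, zero_mul]
    · intro f hf
      have sf := hsum ⟨f, hf⟩
      simp only [Fin.sum_univ_two] at sf
      set m : LamMod a := ⟨f, hf⟩
      refine ⟨e.repr m 0 * e.repr Q 1 - e.repr m 1 * e.repr Q 0,
        e.repr m 1 * e.repr one 0 - e.repr m 0 * e.repr one 1, ?_⟩
      push_cast
      change 1 = _ at s1
      change Q2 a 3 = _ at sQ
      linear_combination
        ((e.repr one 0 : R2) * e.repr Q 1 - (e.repr one 1 : R2) * e.repr Q 0) * sf
        - ((e.repr m 0 : R2) * e.repr Q 1 - (e.repr m 1 : R2) * e.repr Q 0) * s1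
        - ((e.repr m 1 : R2) * e.repr one 0 - (e.repr m 0 : R2) * e.repr one 1) * sQ

lemma lineEval_Q2_eq_iff (a : ℕ → ℂ) (c q t : ℂ) {i : ℕ} (hi : t ^ i ≠ 1) :
    lineEval 1 c (Q2 a i) = lineEval t (c * q) (Q2 a i)
      ↔ a i = c ^ i * (q ^ i - 1) / (1 - t ^ i) := by
  have h : 1 - t ^ i ≠ 0 := sub_ne_zero.2 hi.symm
  rw [lineEval_Q2, lineEval_Q2, mul_left_inj' (pow_ne_zero _ Polynomial.X_ne_zero),
    Polynomial.C_inj, eq_div_iff h]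
  constructor <;> intro h' <;> linear_combination h'

/-- If `a` is a sequence of nonzero numbers with `a_i = c^i (q^i-1)/(1-t^i)` for
`i = 1,2,3`, where `q, t` are not roots of unity, `t ≠ q` and `t ≠ q⁻¹`, and if `Λ_a` is
Cohen–Macaulay (equivalently, a free module over `ℂ[Q_1,Q_2]`), then
`a_i = c^i (q^i-1)/(1-t^i)` for all `i ≥ 1`. -/
theorem lambda_CM_implies_qt (a : ℕ → ℂ) (ha : ∀ i : ℕ, 1 ≤ i → a i ≠ 0) (c q t : ℂ)
    (hq : ∀ n : ℕ, 1 ≤ n → q ^ n ≠ 1) (ht : ∀ n : ℕ, 1 ≤ n → t ^ n ≠ 1)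
    (htq : t ≠ q) (hqt : t ≠ q⁻¹)
    (h123 : ∀ i : ℕ, 1 ≤ i → i ≤ 3 → a i = c ^ i * (q ^ i - 1) / (1 - t ^ i))
    (hfree : Module.Free ↥(Bsub a) ↥(LamMod a)) :
    ∀ i : ℕ, 1 ≤ i → a i = c ^ i * (q ^ i - 1) / (1 - t ^ i) := by
  have ht' (i : ℕ) (hi : 1 ≤ i) : 1 - t ^ i ≠ 0 := sub_ne_zero.2 (ht i hi).symm
  have a1 := h123 1 le_rfl (by norm_num)
  have a2 := h123 2 (by norm_num) (by norm_num)
  have a3 := h123 3 (by norm_num) le_rfl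
  have hc : c ≠ 0 := by
    rintro rfl
    exact ha 1 le_rfl (by simpa using a1)
  have hq1 : q - 1 ≠ 0 := sub_ne_zero.2 (by simpa using hq 1 le_rfl)
  have t1 : 1 - t ≠ 0 := by simpa using ht' 1 le_rfl
  have t2 := ht' 2 (by norm_num)
  have t3 := ht' 3 (by norm_num)
  have hqt' : q - t ≠ 0 := sub_ne_zero.2 htq.symm
  have hqt1 : 1 - q * t ≠ 0 := fun h => hqt (eq_inv_of_mul_eq_one_right (by linear_combination -h))
  have h2 : a 2 + a 1 ^ 2 ≠ 0 := by
    have : a 2 + a 1 ^ 2 = 2 * c ^ 2 * (q - 1) * (q - t) / ((1 - t) * (1 - t ^ 2)) := by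
      rw [a1, a2]
      field_simp
      ring
    rw [this]
    simp [hc, hq1, hqt', t1, t2]
  have h3 : a 3 - a 1 ^ 3 ≠ 0 := by
    have : a 3 - a 1 ^ 3
        = 3 * c ^ 3 * (q - 1) * (q - t) * (1 - q * t) / ((1 - t) ^ 2 * (1 - t ^ 3)) := by
      rw [a1, a3]
      field_simp
      ring
    rw [this]
    simp [hc, hq1, hqt', hqt1, t1, t3]
  obtain ⟨D, hD, hmul⟩ := exists_mul_mem_of_free h2 h3 hfree
  have hQ (i : ℕ) (h1 : 1 ≤ i) (h3 : i ≤ 3) :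
      lineEval 1 c (Q2 a i) = lineEval t (c * q) (Q2 a i) :=
    (lineEval_Q2_eq_iff a c q t (ht i h1)).2 (h123 i h1 h3)
  have hB : Bsub a ≤ AlgHom.equalizer (lineEval 1 c) (lineEval t (c * q)) := by
    refine Algebra.adjoin_le ?_
    rintro _ (rfl | rfl)
    · exact hQ 1 le_rfl (by norm_num)
    · exact hQ 2 (by norm_num) (by norm_num)
  have hB' (b : Bsub a) : lineEval 1 c (b : R2) = lineEval t (c * q) (b : R2) := hB b.2
  intro i hi
  rw [← lineEval_Q2_eq_iff a c q t (ht i hi)]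
  obtain ⟨r, s, hrs⟩ := hmul _ (mem_LamMod (Q2_mem_Lam a hi))
  have hD0 : lineEval 1 c (D : R2) ≠ 0 := by
    intro h
    rw [← coeff_zero_lineEval 1 c, h] at hD
    exact hD (Polynomial.coeff_zero 0)
  refine mul_left_cancel₀ hD0 ?_
  conv_rhs => rw [hB' D]
  rw [← map_mul, ← map_mul, hrs]
  simp only [map_add, map_mul, hB' r, hB' s, hQ 3 (by norm_num) le_rfl]
end
end
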